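/- arXiv:1510.08149 — 2 statements merged into one kernel-verified Lean document; each statement's English description precedes it below -/
import Mathlib

section
/- Let a be a 2-automatic sequence on a finite alphabet Δ, and assume every letter of Δ occurs in a. Then a is self-similar if and only if there exist a finite group G, elements t_0, t_1 generating G, a subgroup K of G, and a bijection ψ : G/K → Δ (from the set of left cosets gK) such that a_n = ψ((t_{d_0} t_{d_1} ⋯ t_{d_k}) K) for all n ≥ 1, where d_k ⋯ d_0 are the base-2 digits of n (d_0 least significant). -/
open scoped Classical

/-- `a k` encodes the term of index `k + 1` of a sequence `(a_n)_{n ≥ 1}` indexed from `1`.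
`subSeq p a i j` encodes the subsequence `a^{(i,j)}` defined by `a^{(i,j)}_n = a_{p^i n + j}`
for `n ≥ 1`. -/
def subSeq (p : ℕ) {Δ : Type*} (a : ℕ → Δ) (i j : ℕ) : ℕ → Δ :=
  fun k => a (p ^ i * (k + 1) + j - 1)

/-- `N(a)`: the set of all subsequences `a^{(i,j)}` with `0 ≤ j < p^i`. -/
def NSet (p : ℕ) {Δ : Type*} (a : ℕ → Δ) : Set (ℕ → Δ) :=
  {u | ∃ i j : ℕ, j < p ^ i ∧ u = subSeq p a i j}

/-- `a` is `p`-automatic iff `N(a)` is finite. -/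
def IsAutomatic (p : ℕ) {Δ : Type*} (a : ℕ → Δ) : Prop :=
  (NSet p a).Finite

/-- `a` is self-similar if `a` is equivalent to every `u ∈ N(a)`: each `u ∈ N(a)` is obtained
from `a` by a bijection of the alphabet. -/
def SelfSimilar (p : ℕ) {Δ : Type*} (a : ℕ → Δ) : Prop :=
  ∀ u ∈ NSet p a, ∃ φ : Δ ≃ Δ, ∀ k, u k = φ (a k)

/-- `cayleyWord2 t0 t1 n` is the element `t_{d_0} t_{d_1} ⋯ t_{d_k}` of `G`, where
`d_k ⋯ d_1 d_0` are the base-`2` digits of `n` (least significant first). -/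
def cayleyWord2 {G : Type*} [Group G] (t0 t1 : G) (n : ℕ) : G :=
  (Nat.digits 2 n).foldl (fun g d => g * (if d = 0 then t0 else t1)) 1

theorem cayleyWord2_two_mul_add {G : Type*} [Group G] (t0 t1 : G) (n d : ℕ) (hn : n ≠ 0)
    (hd : d < 2) :
    cayleyWord2 t0 t1 (2 * n + d) = (if d = 0 then t0 else t1) * cayleyWord2 t0 t1 n := by
  have prod_eq (m : ℕ) : cayleyWord2 t0 t1 m =
      ((Nat.digits 2 m).map fun d => if d = 0 then t0 else t1).prod := by
    rw [cayleyWord2, List.prod_eq_foldl, List.foldl_map]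
  rw [prod_eq, prod_eq, add_comm, Nat.digits_add 2 one_lt_two d n hd (Or.inr hn),
    List.map_cons, List.prod_cons]

theorem cayleyWord2_one {G : Type*} [Group G] (t0 t1 : G) : cayleyWord2 t0 t1 1 = t1 := by
  simp [cayleyWord2]

/-- Prefixing the base-`2` expansion of `n` by `i` fixed low digits multiplies the word on the
left by a fixed element. -/
theorem exists_cayleyWord2_eq_mul {G : Type*} [Group G] (t0 t1 : G) (i j : ℕ) (hj : j < 2 ^ i) :
    ∃ g : G, ∀ n, n ≠ 0 → cayleyWord2 t0 t1 (2 ^ i * n + j) = g * cayleyWord2 t0 t1 n := by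
  induction i generalizing j with
  | zero =>
    obtain rfl : j = 0 := by simpa using hj
    exact ⟨1, by simp⟩
  | succ i ih =>
    obtain ⟨g, hg⟩ := ih (j / 2) (by rw [pow_succ] at hj; omega)
    refine ⟨(if j % 2 = 0 then t0 else t1) * g, fun n hn => ?_⟩
    have hsplit : 2 ^ (i + 1) * n + j = 2 * (2 ^ i * n + j / 2) + j % 2 := by
      rw [pow_succ, mul_add, add_assoc, Nat.div_add_mod]
      ring
    rw [hsplit, cayleyWord2_two_mul_add _ _ _ _ (by positivity) (Nat.mod_lt _ two_pos), hg n hn,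
      mul_assoc]

theorem selfSimilar_of_cayleyWord2 {Δ G : Type*} [Group G] (a : ℕ → Δ) (t0 t1 : G)
    (K : Subgroup G) (ψ : (G ⧸ K) ≃ Δ)
    (h : ∀ k : ℕ, a k = ψ ((cayleyWord2 t0 t1 (k + 1) : G) : G ⧸ K)) : SelfSimilar 2 a := by
  rintro u ⟨i, j, hj, rfl⟩
  obtain ⟨g, hg⟩ := exists_cayleyWord2_eq_mul t0 t1 i j hj
  refine ⟨(ψ.symm.trans (MulAction.toPerm g)).trans ψ, fun k => ?_⟩
  have hpos : 1 ≤ 2 ^ i * (k + 1) + j := Nat.le_add_right_of_le (Nat.mul_pos (by simp) k.succ_pos)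
  rw [subSeq, h, h k, Nat.sub_add_cancel hpos, hg _ k.succ_ne_zero]
  simp only [Equiv.trans_apply, Equiv.symm_apply_apply, MulAction.toPerm_apply,
    MulAction.Quotient.smul_mk, smul_eq_mul]

/-- If `x` satisfies `t1 • x = a_1`, and passing from `n` to `2 n` and `2 n + 1` acts on the terms
of `a` by `t0` and `t1`, then `a_n` is the image of `x` under the word of `n`. -/
theorem eq_cayleyWord2_smul {Δ G : Type*} [Group G] [MulAction G Δ] (a : ℕ → Δ) (t0 t1 : G)
    (x : Δ) (hx : a 0 = t1 • x) (h0 : ∀ k, a (2 * k + 1) = t0 • a k)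
    (h1 : ∀ k, a (2 * k + 2) = t1 • a k) (k : ℕ) : a k = cayleyWord2 t0 t1 (k + 1) • x := by
  induction k using Nat.strong_induction_on with
  | _ k ih =>
    obtain rfl | ⟨m, rfl | rfl⟩ : k = 0 ∨ ∃ m, k = 2 * m + 1 ∨ k = 2 * m + 2 := by
      by_cases hk : k = 0
      · exact Or.inl hk
      · exact Or.inr ⟨(k - 1) / 2, by omega⟩
    · rw [zero_add, cayleyWord2_one, hx]
    · rw [h0, ih m (by omega), smul_smul]
      congr 1
      exact (cayleyWord2_two_mul_add t0 t1 (m + 1) 0 m.succ_ne_zero two_pos).symm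
    · rw [h1, ih m (by omega), smul_smul]
      congr 1
      exact (cayleyWord2_two_mul_add t0 t1 (m + 1) 1 m.succ_ne_zero one_lt_two).symm

theorem SelfSimilar.exists_cayleyWord2 {Δ : Type} [Finite Δ] (a : ℕ → Δ)
    (hsurj : Function.Surjective a) (h : SelfSimilar 2 a) :
    ∃ (G : GrpCat.{0}) (t0 t1 : ↥G) (K : Subgroup ↥G) (ψ : (↥G ⧸ K) ≃ Δ), Finite ↥G ∧
      Subgroup.closure {t0, t1} = ⊤ ∧
      ∀ k : ℕ, a k = ψ ((cayleyWord2 t0 t1 (k + 1) : ↥G) : ↥G ⧸ K) := by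
  obtain ⟨σ0, h0⟩ := h _ ⟨1, 0, by norm_num, rfl⟩
  obtain ⟨σ1, h1⟩ := h _ ⟨1, 1, by norm_num, rfl⟩
  let H : Subgroup (Equiv.Perm Δ) := Subgroup.closure {σ0, σ1}
  let t0 : H := ⟨σ0, Subgroup.subset_closure (by simp)⟩
  let t1 : H := ⟨σ1, Subgroup.subset_closure (by simp)⟩
  have hgen : Subgroup.closure {t0, t1} = ⊤ := by
    rw [← Subgroup.closure_closure_coe_preimage (k := {σ0, σ1})]
    congr 1
    ext g
    simp [t0, t1, Subtype.ext_iff]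
  let x : Δ := σ1.symm (a 0)
  have hword : ∀ k, a k = cayleyWord2 t0 t1 (k + 1) • x :=
    eq_cayleyWord2_smul a t0 t1 x (σ1.apply_symm_apply _).symm
      (fun k => h0 k) (fun k => h1 k)
  have horbit : MulAction.orbit H x = Set.univ := by
    refine Set.eq_univ_of_forall fun y => ?_
    obtain ⟨k, rfl⟩ := hsurj y
    exact ⟨_, (hword k).symm⟩
  refine ⟨GrpCat.of H, t0, t1, MulAction.stabilizer H x,
    (MulAction.orbitEquivQuotientStabilizer H x).symm.trans
      ((Equiv.setCongr horbit).trans (Equiv.Set.univ Δ)), inferInstanceAs (Finite H), hgen,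
    fun k => ?_⟩
  rw [hword k]
  exact (MulAction.orbitEquivQuotientStabilizer_symm_apply H x _).symm

theorem SelfSimilar.comp_equiv {Δ Δ' : Type*} {p : ℕ} {a : ℕ → Δ} (h : SelfSimilar p a)
    (e : Δ ≃ Δ') : SelfSimilar p (e ∘ a) := by
  rintro u ⟨i, j, hj, rfl⟩
  obtain ⟨φ, hφ⟩ := h _ ⟨i, j, hj, rfl⟩
  exact ⟨(e.symm.trans φ).trans e, fun k => by
    simpa [subSeq, -EmbeddingLike.apply_eq_iff_eq] using congrArg e (hφ k)⟩

/-- A `2`-automatic sequence `a` using every letter of its alphabet is self-similar iff it is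
produced by an automaton whose underlying graph is the Cayley graph of a finite group `G` with
generators `t0, t1`, initial state `1`, and labeling map the natural projection `G → G/K`
(composed with a bijection `ψ : G/K ≃ Δ`) for some subgroup `K`. -/
theorem stmt_11 {Δ : Type*} [Finite Δ] (a : ℕ → Δ) (ha : IsAutomatic 2 a)
    (hsurj : Function.Surjective a) :
    SelfSimilar 2 a ↔
      ∃ (G : GrpCat.{0}) (t0 t1 : ↥G) (K : Subgroup ↥G) (ψ : (↥G ⧸ K) ≃ Δ), Finite ↥G ∧
        Subgroup.closure {t0, t1} = ⊤ ∧
        ∀ k : ℕ, a k = ψ ((cayleyWord2 t0 t1 (k + 1) : ↥G) : ↥G ⧸ K) := by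
  constructor
  · intro h
    obtain ⟨n, ⟨e⟩⟩ := Finite.exists_equiv_fin Δ
    obtain ⟨G, t0, t1, K, ψ, hfin, hgen, hword⟩ :=
      (h.comp_equiv e).exists_cayleyWord2 _ (e.surjective.comp hsurj)
    exact ⟨G, t0, t1, K, ψ.trans e.symm, hfin, hgen, fun k => by
      rw [Equiv.trans_apply, ← hword k, Function.comp_apply, e.symm_apply_apply]⟩
  · rintro ⟨G, t0, t1, K, ψ, -, -, hword⟩
    exact selfSimilar_of_cayleyWord2 a t0 t1 K ψ hword
end

section
/- Let p ≥ 2 and let a be a p-automatic sequence on the finite alphabet {d_1, …, d_r}. For each i and each n ≥ 1, let c_{i,n} = #{ m : p^{n−1} ≤ m < p^n, a_m = d_i }, and let F_i = Σ_{n≥1} c_{i,n} x^n ∈ ℚ[[x]]. Suppose P_1, …, P_r, D ∈ ℤ[x] satisfy D(0) ≠ 0 and D · F_i = P_i in ℚ[[x]] for each i. Assume every complex root of D has absolute value ≥ 1/p, that the only root of D of absolute value exactly 1/p is 1/p itself, and that 1/p is a simple root of D. Then for each i, the limit of a[p^n, d_i]/p^n as n → ∞ exists and equals (p²/(1−p))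 · P_i(1/p) / D′(1/p); moreover Σ_{j=1}^{r} P_j(1/p) ≠ 0 and this limit equals P_i(1/p) / Σ_{j=1}^{r} P_j(1/p). -/
open scoped Classical

/-- `a[p^n, d_i]`: the number of indices `1 ≤ m ≤ p^n` with `a_m = i`. -/
def letterCount (p : ℕ) {r : ℕ} (a : ℕ → Fin r) (i : Fin r) (n : ℕ) : ℕ :=
  ((Finset.range (p ^ n)).filter (fun m => a m = i)).card

/-- `c_{i,n}`: the number of integers `m` with `p^(n-1) ≤ m < p^n` (i.e. of base-`p` length
`n`) such that `a_m = d_i`. -/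
def letterCountLen (p : ℕ) {r : ℕ} (a : ℕ → Fin r) (i : Fin r) (n : ℕ) : ℕ :=
  ((Finset.Ico (p ^ (n - 1)) (p ^ n)).filter (fun m => a (m - 1) = i)).card

open Filter Topology Polynomial

/-- Absolute convergence at `s` is preserved by products of power series, and evaluation at `s`
is multiplicative. -/
lemma summable_norm_coeff_mul_pow {f g : PowerSeries ℂ} {s : ℂ}
    (hf : Summable fun n => ‖PowerSeries.coeff n f * s ^ n‖)
    (hg : Summable fun n => ‖PowerSeries.coeff n g * s ^ n‖) :
    (Summable fun n => ‖PowerSeries.coeff n (f * g) * s ^ n‖) ∧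
      ∑' n, PowerSeries.coeff n (f * g) * s ^ n =
        (∑' n, PowerSeries.coeff n f * s ^ n) * ∑' n, PowerSeries.coeff n g * s ^ n := by
  have key : ∀ n, PowerSeries.coeff n (f * g) * s ^ n =
      ∑ kl ∈ Finset.HasAntidiagonal.antidiagonal n,
        (PowerSeries.coeff kl.1 f * s ^ kl.1) * (PowerSeries.coeff kl.2 g * s ^ kl.2) := by
    intro n
    rw [PowerSeries.coeff_mul, Finset.sum_mul]
    refine Finset.sum_congr rfl fun kl hkl => ?_
    rw [← Finset.HasAntidiagonal.mem_antidiagonal.mp hkl, pow_add]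
    ring
  simp only [key]
  constructor
  · exact summable_norm_sum_mul_antidiagonal_of_summable_norm
      (f := fun n => PowerSeries.coeff n f * s ^ n) (g := fun n => PowerSeries.coeff n g * s ^ n)
      hf hg
  · exact (tsum_mul_tsum_eq_tsum_sum_antidiagonal_of_summable_norm
      (f := fun n => PowerSeries.coeff n f * s ^ n) (g := fun n => PowerSeries.coeff n g * s ^ n)
      hf hg).symm

/-- A polynomial, seen as a power series, converges absolutely everywhere, to its evaluation. -/
lemma summable_norm_coeff_coe (Q : ℂ[X]) (s : ℂ) :
    (Summable fun n => ‖PowerSeries.coeff n (Q : PowerSeries ℂ) * s ^ n‖) ∧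
      ∑' n, PowerSeries.coeff n (Q : PowerSeries ℂ) * s ^ n = Q.eval s := by
  have hz : ∀ n ∉ Finset.range (Q.natDegree + 1), Q.coeff n * s ^ n = 0 := by
    intro n hn
    rw [Q.coeff_eq_zero_of_natDegree_lt (by simpa using hn), zero_mul]
  simp only [Polynomial.coeff_coe]
  refine ⟨summable_of_ne_finset_zero (s := Finset.range (Q.natDegree + 1)) fun n hn => ?_, ?_⟩
  · rw [hz n hn, norm_zero]
  · rw [tsum_eq_sum hz, Polynomial.eval_eq_sum_range]

/-- Dividing by `X - z` with `‖s‖ < ‖z‖` preserves absolute convergence at `s`. -/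
lemma summable_of_X_sub_C_mul {f : PowerSeries ℂ} {s z : ℂ} (hz : ‖s‖ < ‖z‖)
    (h : Summable fun n => ‖PowerSeries.coeff n (((X - C z : ℂ[X]) : PowerSeries ℂ) * f) * s ^ n‖) :
    Summable fun n => ‖PowerSeries.coeff n f * s ^ n‖ := by
  have hz0 : z ≠ 0 := norm_pos_iff.mp ((norm_nonneg s).trans_lt hz)
  set u : PowerSeries ℂ := PowerSeries.mk fun n => -(z⁻¹) ^ (n + 1) with hu
  have hinv : u * ((X - C z : ℂ[X]) : PowerSeries ℂ) = 1 := by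
    rw [mul_comm]
    ext n
    rw [Polynomial.coe_sub, Polynomial.coe_X, Polynomial.coe_C, sub_mul, map_sub,
      PowerSeries.coeff_C_mul, hu]
    cases n with
    | zero => simp [hz0]
    | succ n =>
      rw [PowerSeries.coeff_succ_X_mul, PowerSeries.coeff_mk, PowerSeries.coeff_mk,
        PowerSeries.coeff_one, if_neg n.succ_ne_zero, pow_succ _ (n + 1), mul_neg,
        mul_left_comm, mul_inv_cancel₀ hz0]
      ring
  have hsum : Summable fun n => ‖PowerSeries.coeff n u * s ^ n‖ := by
    have hlt : ‖s‖ / ‖z‖ < 1 := (div_lt_one ((norm_nonneg s).trans_lt hz)).mpr hz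
    refine ((summable_geometric_of_lt_one (by positivity) hlt).mul_left ‖z‖⁻¹).congr fun n => ?_
    rw [hu, PowerSeries.coeff_mk, norm_mul, norm_neg, norm_pow, norm_pow, norm_inv,
      div_eq_mul_inv, mul_pow]
    ring
  have := (summable_norm_coeff_mul_pow hsum h).1
  rwa [← mul_assoc, hinv, one_mul] at this

/-- Dividing by a polynomial all of whose roots have absolute value `> ‖s‖` preserves absolute
convergence at `s`. -/
lemma summable_of_polynomial_mul {E : ℂ[X]} (hE : E ≠ 0) {f : PowerSeries ℂ} {s : ℂ}
    (hroots : ∀ z, E.eval z = 0 → ‖s‖ < ‖z‖)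
    (h : Summable fun n => ‖PowerSeries.coeff n ((E : PowerSeries ℂ) * f) * s ^ n‖) :
    Summable fun n => ‖PowerSeries.coeff n f * s ^ n‖ := by
  have aux : ∀ m : Multiset ℂ, (∀ z ∈ m, ‖s‖ < ‖z‖) → ∀ f : PowerSeries ℂ,
      (Summable fun n => ‖PowerSeries.coeff n
        ((((m.map fun z => X - C z).prod : ℂ[X]) : PowerSeries ℂ) * f) * s ^ n‖) →
      Summable fun n => ‖PowerSeries.coeff n f * s ^ n‖ := by
    intro m
    induction m using Multiset.induction with
    | empty => intro _ f hf; simpa using hf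
    | cons z m ih =>
      intro hm f hf
      refine ih (fun w hw => hm w (Multiset.mem_cons_of_mem hw)) f ?_
      refine summable_of_X_sub_C_mul (hm z (Multiset.mem_cons_self z m)) ?_
      rwa [Multiset.map_cons, Multiset.prod_cons, Polynomial.coe_mul, mul_assoc] at hf
  have hlc : E.leadingCoeff ≠ 0 := leadingCoeff_ne_zero.mpr hE
  refine aux E.roots (fun z hz => hroots z (isRoot_of_mem_roots hz)) f ?_
  have hmon := (summable_norm_coeff_mul_pow
    (summable_norm_coeff_coe (C E.leadingCoeff⁻¹) s).1 h).1
  have hEq : (C E.leadingCoeff⁻¹ : ℂ[X]) * E = (E.roots.map fun z => X - C z).prod := by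
    conv_lhs => enter [2]; rw [(IsAlgClosed.splits E).eq_prod_roots]
    rw [← mul_assoc, ← C_mul, inv_mul_cancel₀ hlc, C_1, one_mul]
  rwa [← mul_assoc, ← Polynomial.coe_mul, hEq] at hmon

/-- Asymptotics of the coefficients of a rational function `P / D` with a unique pole `s` of
smallest absolute value, which is simple. -/
lemma tendsto_coeff_mul_pow_of_simple_pole {D P : ℂ[X]} {c : ℕ → ℂ} {s : ℂ} (hs : s ≠ 0)
    (h : (D : PowerSeries ℂ) * PowerSeries.mk c = P)
    (hroots : ∀ z, D.eval z = 0 → ‖s‖ ≤ ‖z‖)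
    (honly : ∀ z, D.eval z = 0 → ‖z‖ = ‖s‖ → z = s)
    (hroot : D.eval s = 0) (hsimple : D.derivative.eval s ≠ 0) :
    Tendsto (fun n => c n * s ^ n) atTop (𝓝 (-(P.eval s / (s * D.derivative.eval s)))) := by
  obtain ⟨E, rfl⟩ := dvd_iff_isRoot.mpr hroot
  have hder : (derivative ((X - C s) * E)).eval s = E.eval s := by simp
  rw [hder] at hsimple ⊢
  have hE : E ≠ 0 := by rintro rfl; simp at hsimple
  have hEroots : ∀ z, E.eval z = 0 → ‖s‖ < ‖z‖ := by
    intro z hz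
    have hz' : ((X - C s) * E).eval z = 0 := by rw [eval_mul, hz, mul_zero]
    refine (hroots z hz').lt_of_ne fun heq => hsimple ?_
    rwa [honly z hz' heq.symm] at hz
  set G : PowerSeries ℂ := ((X - C s : ℂ[X]) : PowerSeries ℂ) * PowerSeries.mk c with hG
  have hEG : (E : PowerSeries ℂ) * G = P := by
    rw [← h, hG, Polynomial.coe_mul]
    ring
  have hGsum : Summable fun n => ‖PowerSeries.coeff n G * s ^ n‖ := by
    refine summable_of_polynomial_mul hE hEroots ?_
    rw [hEG]
    exact (summable_norm_coeff_coe P s).1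
  have hval : ∑' n, PowerSeries.coeff n G * s ^ n = P.eval s / E.eval s := by
    have := (summable_norm_coeff_mul_pow
      (summable_norm_coeff_coe E s).1 hGsum).2
    rw [hEG, (summable_norm_coeff_coe P s).2,
      (summable_norm_coeff_coe E s).2] at this
    rw [this, mul_div_cancel_left₀ _ hsimple]
  have hpartial : ∀ n, ∑ k ∈ Finset.range (n + 1), PowerSeries.coeff k G * s ^ k =
      -s * (c n * s ^ n) := by
    intro n
    induction n with
    | zero => simp [hG]
    | succ n ih =>
      rw [Finset.sum_range_succ, ih, hG, Polynomial.coe_sub, Polynomial.coe_X, Polynomial.coe_C,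
        sub_mul, map_sub, PowerSeries.coeff_C_mul, PowerSeries.coeff_succ_X_mul,
        PowerSeries.coeff_mk, PowerSeries.coeff_mk]
      ring
  have hlim := (tendsto_add_atTop_iff_nat 1).mpr hGsum.of_norm.hasSum.tendsto_sum_nat
  simp only [hpartial, hval] at hlim
  have := hlim.const_mul (-s⁻¹)
  refine (this.congr fun n => ?_).trans_eq ?_
  · field_simp
  · congr 1
    field_simp

/-- If `c k / p ^ k` converges to `V`, then the partial sums of `c`, divided by `p ^ n`, converge
to `V * (p / (p - 1))`. -/
lemma tendsto_sum_range_div_pow {p : ℝ} (hp : 1 < p) {c : ℕ → ℝ} {V : ℝ}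
    (hc : Tendsto (fun n => c n / p ^ n) atTop (𝓝 V)) :
    Tendsto (fun n => (∑ k ∈ Finset.range (n + 1), c k) / p ^ n) atTop
      (𝓝 (V * (p / (p - 1)))) := by
  have hp0 : 0 < p := by linarith
  have hp1 : p - 1 ≠ 0 := by linarith
  have hgeom : ∀ n, ∑ k ∈ Finset.range n, p ^ k = (p ^ n - 1) / (p - 1) :=
    fun n => geom_sum_eq hp.ne' n
  have hpow : Tendsto (fun n : ℕ => p ^ n) atTop atTop := tendsto_pow_atTop_atTop_of_one_lt hp
  have hlittle : (fun k => c k - V * p ^ k) =o[atTop] fun k : ℕ => p ^ k := by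
    rw [Asymptotics.isLittleO_iff_tendsto' (Eventually.of_forall fun k hk =>
      absurd hk (pow_pos hp0 k).ne')]
    have := hc.sub_const V
    rw [sub_self] at this
    refine this.congr fun n => ?_
    have := (pow_pos hp0 n).ne'
    field_simp
  have hsumtop : Tendsto (fun n => ∑ k ∈ Finset.range n, p ^ k) atTop atTop := by
    simp only [hgeom]
    exact (tendsto_atTop_add_const_right _ (-1) hpow).atTop_div_const (by linarith)
  have hdiv := (hlittle.sum_range (fun k => (pow_pos hp0 k).le) hsumtop).tendsto_div_nhds_zero
  have hdiv := (tendsto_add_atTop_iff_nat 1).mpr hdiv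
  have hratio : Tendsto (fun n : ℕ => (∑ k ∈ Finset.range (n + 1), p ^ k) / p ^ n) atTop
      (𝓝 (p / (p - 1))) := by
    have h1 : Tendsto (fun n : ℕ => (p - (p ^ n)⁻¹) / (p - 1)) atTop (𝓝 ((p - 0) / (p - 1))) :=
      ((tendsto_const_nhds).sub hpow.inv_tendsto_atTop).div_const _
    rw [sub_zero] at h1
    refine h1.congr fun n => ?_
    rw [hgeom, pow_succ]
    have := (pow_pos hp0 n).ne'
    field_simp
  have hfin := (hdiv.mul hratio).add (hratio.const_mul V)
  rw [zero_mul, zero_add] at hfin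
  refine hfin.congr fun n => ?_
  have hpos : (∑ k ∈ Finset.range (n + 1), p ^ k) ≠ 0 :=
    (Finset.sum_pos (fun k _ => pow_pos hp0 k) (by simp)).ne'
  have := (pow_pos hp0 n).ne'
  rw [Finset.sum_sub_distrib, ← Finset.mul_sum]
  field_simp
  ring

lemma sum_letterCountLen {p : ℕ} (hp : 0 < p) {r : ℕ} (a : ℕ → Fin r) (i : Fin r) (n : ℕ) :
    ∑ k ∈ Finset.range (n + 1), letterCountLen p a i k =
      ((Finset.Ico 1 (p ^ n)).filter (fun m => a (m - 1) = i)).card := by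
  induction n with
  | zero => simp [letterCountLen]
  | succ n ih =>
    rw [Finset.sum_range_succ, ih, letterCountLen, Nat.add_sub_cancel,
      ← Finset.card_union_of_disjoint, ← Finset.filter_union,
      Finset.Ico_union_Ico_eq_Ico (Nat.one_le_pow _ _ hp) (Nat.pow_le_pow_right hp n.le_succ)]
    exact Finset.disjoint_filter_filter (Finset.Ico_disjoint_Ico_consecutive _ _ _)

lemma letterCount_eq_sum {p : ℕ} (hp : 0 < p) {r : ℕ} (a : ℕ → Fin r) (i : Fin r) (n : ℕ) :
    letterCount p a i n =
      ∑ k ∈ Finset.range (n + 1), letterCountLen p a i k +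
        if a (p ^ n - 1) = i then 1 else 0 := by
  have hpn : 1 ≤ p ^ n := Nat.one_le_pow _ _ hp
  rw [sum_letterCountLen hp, letterCount, Finset.card_filter, Finset.card_filter,
    ← Finset.sum_Ico_succ_top hpn (fun m => if a (m - 1) = i then 1 else 0),
    Finset.sum_Ico_eq_sum_range]
  simp

lemma sum_letterCount (p : ℕ) {r : ℕ} (a : ℕ → Fin r) (n : ℕ) :
    ∑ i, letterCount p a i n = p ^ n := by
  simp only [letterCount]
  rw [← Finset.card_eq_sum_card_fiberwise (fun _ _ => Finset.mem_coe.mpr (Finset.mem_univ _)),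
    Finset.card_range]

lemma eval_map_intCast_complex (Q : ℤ[X]) (x : ℝ) :
    (Q.map (Int.castRingHom ℂ)).eval (x : ℂ) = ((Q.map (Int.castRingHom ℝ)).eval x : ℝ) := by
  have : Q.map (Int.castRingHom ℂ) = (Q.map (Int.castRingHom ℝ)).map Complex.ofRealHom := by
    rw [Polynomial.map_map]
    congr 1
  rw [this, ← Complex.ofRealHom_eq_coe, Polynomial.eval_map_apply]
  rfl

/-- Existence of letter frequencies along powers of `p`: with `F_i = ∑_n c_{i,n} x^n` and
`D · F_i = P_i`, if all complex roots of `D` have absolute value `≥ 1/p`, the only root of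
absolute value exactly `1/p` is `1/p` itself, and `1/p` is a simple root, then
`a[p^n, d_i]/p^n → (p²/(1-p)) P_i(1/p)/D'(1/p) = P_i(1/p) / ∑_j P_j(1/p)`. -/
theorem stmt_19 {p : ℕ} (hp : 2 ≤ p) {r : ℕ} (a : ℕ → Fin r) (ha : IsAutomatic p a)
    (P : Fin r → Polynomial ℤ) (D : Polynomial ℤ) (hD0 : D.eval 0 ≠ 0)
    (hPD : ∀ i : Fin r,
      ((D.map (Int.castRingHom ℚ) : Polynomial ℚ) : PowerSeries ℚ) *
          PowerSeries.mk (fun n => (letterCountLen p a i n : ℚ))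
        = (((P i).map (Int.castRingHom ℚ) : Polynomial ℚ) : PowerSeries ℚ))
    (hroots : ∀ z : ℂ, (D.map (Int.castRingHom ℂ)).eval z = 0 →
      (1 : ℝ) / p ≤ ‖z‖)
    (honly : ∀ z : ℂ, (D.map (Int.castRingHom ℂ)).eval z = 0 → ‖z‖ = 1 / p →
      z = 1 / p)
    (hroot : (D.map (Int.castRingHom ℝ)).eval (1 / (p : ℝ)) = 0)
    (hsimple : (D.map (Int.castRingHom ℝ)).derivative.eval (1 / (p : ℝ)) ≠ 0) :
    (∑ j : Fin r, ((P j).map (Int.castRingHom ℝ)).eval (1 / (p : ℝ))) ≠ 0 ∧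
    ∀ i : Fin r,
      Filter.Tendsto (fun n : ℕ => (letterCount p a i n : ℝ) / (p : ℝ) ^ n)
        Filter.atTop
        (nhds ((p : ℝ) ^ 2 / (1 - (p : ℝ)) *
          ((P i).map (Int.castRingHom ℝ)).eval (1 / (p : ℝ)) /
          (D.map (Int.castRingHom ℝ)).derivative.eval (1 / (p : ℝ)))) ∧
      (p : ℝ) ^ 2 / (1 - (p : ℝ)) * ((P i).map (Int.castRingHom ℝ)).eval (1 / (p : ℝ)) /
          (D.map (Int.castRingHom ℝ)).derivative.eval (1 / (p : ℝ))
        = ((P i).map (Int.castRingHom ℝ)).eval (1 / (p : ℝ)) /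
          ∑ j : Fin r, ((P j).map (Int.castRingHom ℝ)).eval (1 / (p : ℝ)) := by
  have hp1 : (1 : ℝ) < p := by exact_mod_cast hp
  have hp0 : (p : ℝ) ≠ 0 := by positivity
  have hs : (((1 / (p : ℝ) : ℝ)) : ℂ) = 1 / (p : ℂ) := by push_cast; rfl
  have hs0 : (((1 / (p : ℝ) : ℝ)) : ℂ) ≠ 0 := by exact_mod_cast one_div_ne_zero hp0
  have hnorm : ‖(((1 / (p : ℝ) : ℝ)) : ℂ)‖ = 1 / p := by
    rw [Complex.norm_real, Real.norm_of_nonneg (by positivity)]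
  have hlen : ∀ i, Tendsto (fun n => (letterCountLen p a i n : ℝ) / (p : ℝ) ^ n) atTop
      (𝓝 (-(((P i).map (Int.castRingHom ℝ)).eval (1 / (p : ℝ)) /
        (1 / (p : ℝ) * (D.map (Int.castRingHom ℝ)).derivative.eval (1 / (p : ℝ)))))) := by
    intro i
    have hmap : ∀ Q : ℤ[X], PowerSeries.map (algebraMap ℚ ℂ)
        ((Q.map (Int.castRingHom ℚ) : ℚ[X]) : PowerSeries ℚ) =
        ((Q.map (Int.castRingHom ℂ) : ℂ[X]) : PowerSeries ℂ) := by
      intro Q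
      ext n
      simp
    have hC := congrArg (PowerSeries.map (algebraMap ℚ ℂ)) (hPD i)
    rw [map_mul, hmap, hmap] at hC
    have hmk : PowerSeries.map (algebraMap ℚ ℂ)
        (PowerSeries.mk fun n => (letterCountLen p a i n : ℚ)) =
        PowerSeries.mk fun n => (letterCountLen p a i n : ℂ) := by
      ext n
      simp
    rw [hmk] at hC
    have hder : (D.map (Int.castRingHom ℂ)).derivative.eval (((1 / (p : ℝ) : ℝ)) : ℂ) =
        ((D.map (Int.castRingHom ℝ)).derivative.eval (1 / (p : ℝ)) : ℝ) := by
      rw [derivative_map, derivative_map, eval_map_intCast_complex]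
    have hlim := tendsto_coeff_mul_pow_of_simple_pole hs0 hC
      (fun z hz => hnorm.trans_le (hroots z hz)) (fun z hz hzn => (honly z hz (hzn.trans hnorm)).trans hs.symm)
      (by rw [eval_map_intCast_complex, hroot, Complex.ofReal_zero])
      (by rw [hder]; exact_mod_cast hsimple)
    rw [hder, eval_map_intCast_complex] at hlim
    refine ((Complex.continuous_re.tendsto _).comp hlim).congr (fun n => ?_) |>.trans_eq ?_
    · rw [Function.comp_apply, ← Complex.ofReal_pow, ← Complex.ofReal_natCast,
        ← Complex.ofReal_mul, Complex.ofReal_re, one_div, inv_pow, div_eq_mul_inv]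
    · rw [← Complex.ofReal_mul, ← Complex.ofReal_div, ← Complex.ofReal_neg, Complex.ofReal_re]
  have hfreq : ∀ i, Tendsto (fun n => (letterCount p a i n : ℝ) / (p : ℝ) ^ n) atTop
      (𝓝 ((p : ℝ) ^ 2 / (1 - (p : ℝ)) * ((P i).map (Int.castRingHom ℝ)).eval (1 / (p : ℝ)) /
        (D.map (Int.castRingHom ℝ)).derivative.eval (1 / (p : ℝ)))) := by
    intro i
    have herr : Tendsto (fun n : ℕ =>
        ((if a (p ^ n - 1) = i then 1 else 0 : ℕ) : ℝ) / (p : ℝ) ^ n) atTop (𝓝 0) := by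
      refine squeeze_zero (fun n => by positivity) (fun n => ?_)
        (tendsto_pow_atTop_atTop_of_one_lt hp1).inv_tendsto_atTop
      rw [Pi.inv_apply, ← one_div]
      gcongr
      split_ifs <;> simp
    have hsum := (tendsto_sum_range_div_pow hp1 (hlen i)).add herr
    refine (hsum.congr fun n => ?_).trans_eq ?_
    · rw [letterCount_eq_sum (zero_lt_two.trans_le hp)]
      push_cast
      rw [add_div]
    · have h1 : (p : ℝ) - 1 ≠ 0 := by linarith
      have h2 : 1 - (p : ℝ) ≠ 0 := by linarith
      congr 1
      rw [add_zero]
      field_simp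
      ring
  have hone : ∑ i, (p : ℝ) ^ 2 / (1 - (p : ℝ)) *
      ((P i).map (Int.castRingHom ℝ)).eval (1 / (p : ℝ)) /
        (D.map (Int.castRingHom ℝ)).derivative.eval (1 / (p : ℝ)) = 1 := by
    refine tendsto_nhds_unique (tendsto_finsetSum _ fun i _ => hfreq i)
      (tendsto_const_nhds.congr fun n => ?_)
    rw [← Finset.sum_div, ← Nat.cast_sum, sum_letterCount, Nat.cast_pow,
      div_self (pow_ne_zero n hp0)]
  rw [← Finset.sum_div, ← Finset.mul_sum] at hone
  have hne : (∑ j : Fin r, ((P j).map (Int.castRingHom ℝ)).eval (1 / (p : ℝ))) ≠ 0 := by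
    intro h0
    rw [h0, mul_zero, zero_div] at hone
    exact zero_ne_one hone
  refine ⟨hne, fun i => ⟨hfreq i, ?_⟩⟩
  rw [eq_div_iff hne]
  linear_combination ((P i).map (Int.castRingHom ℝ)).eval (1 / (p : ℝ)) * hone
end
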